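/- Let M and N be models of DB₀ such that N is a Δ₀-elementary cofinal extension of M, and let n ≥ 0. Then: (1) if M ⊨ Coll(Σ_{n+1}) then M ≺_{Σ_{n+2}} N; and (2) if M ⊨ Coll_s(Σ_{n+1}) then N ⊨ Coll_s(Σ_{n+1}). -/

import Mathlib

/- A deep embedding of the first-order language of set theory L_∈ = {∈, =},
   with named variables indexed by ℕ. -/

namespace FOSet

/-- Formulas of L_∈ with variables indexed by ℕ. -/
inductive Fml : Type
  | mem : ℕ → ℕ → Fml
  | eq  : ℕ → ℕ → Fml
  | not : Fml → Fml
  | and : Fml → Fml → Fml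
  | or  : Fml → Fml → Fml
  | imp : Fml → Fml → Fml
  | all : ℕ → Fml → Fml
  | ex  : ℕ → Fml → Fml

namespace Fml

/-- Free variables of a formula. -/
def fv : Fml → Set ℕ
  | mem i j => {i, j}
  | eq i j  => {i, j}
  | not φ   => φ.fv
  | and φ ψ => φ.fv ∪ ψ.fv
  | or φ ψ  => φ.fv ∪ ψ.fv
  | imp φ ψ => φ.fv ∪ ψ.fv
  | all i φ => φ.fv \ {i}
  | ex i φ  => φ.fv \ {i}

end Fml

/-- Satisfaction, in the substructure of `(N, E)` with domain `S`, of a formula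
under a valuation `v` : quantifiers range over `S`. -/
def SatIn {N : Type} (E : N → N → Prop) (S : Set N) : (ℕ → N) → Fml → Prop
  | v, .mem i j => E (v i) (v j)
  | v, .eq i j  => v i = v j
  | v, .not φ   => ¬ SatIn E S v φ
  | v, .and φ ψ => SatIn E S v φ ∧ SatIn E S v ψ
  | v, .or φ ψ  => SatIn E S v φ ∨ SatIn E S v ψ
  | v, .imp φ ψ => SatIn E S v φ → SatIn E S v ψ
  | v, .all i φ => ∀ a ∈ S, SatIn E S (Function.update v i a) φ
  | v, .ex i φ  => ∃ a ∈ S, SatIn E S (Function.update v i a) φ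

/-- Satisfaction in the full structure `(N, E)`. -/
def Sat {N : Type} (E : N → N → Prop) (v : ℕ → N) (φ : Fml) : Prop :=
  SatIn E Set.univ v φ

/-- Δ₀ (= Σ₀ = Π₀) formulas: every quantifier is bounded, i.e. of the form
`∀ x ∈ y` or `∃ x ∈ y`. -/
inductive IsDelta0 : Fml → Prop
  | mem (i j : ℕ) : IsDelta0 (Fml.mem i j)
  | eq (i j : ℕ)  : IsDelta0 (Fml.eq i j)
  | not {φ} : IsDelta0 φ → IsDelta0 φ.not
  | and {φ ψ} : IsDelta0 φ → IsDelta0 ψ → IsDelta0 (φ.and ψ)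
  | or {φ ψ}  : IsDelta0 φ → IsDelta0 ψ → IsDelta0 (φ.or ψ)
  | imp {φ ψ} : IsDelta0 φ → IsDelta0 ψ → IsDelta0 (φ.imp ψ)
  | ball {i j : ℕ} {φ} : i ≠ j → IsDelta0 φ →
      IsDelta0 (Fml.all i ((Fml.mem i j).imp φ))
  | bex {i j : ℕ} {φ} : i ≠ j → IsDelta0 φ →
      IsDelta0 (Fml.ex i ((Fml.mem i j).and φ))

/-- The Lévy hierarchy: `(levels n).1` is the class of Σ_n formulas and
`(levels n).2` the class of Π_n formulas. -/
def levels : ℕ → (Fml → Prop) × (Fml → Prop)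
  | 0 => (IsDelta0, IsDelta0)
  | n + 1 =>
      (fun φ => ∃ i ψ, (levels n).2 ψ ∧ φ = Fml.ex i ψ,
       fun φ => ∃ i ψ, (levels n).1 ψ ∧ φ = Fml.all i ψ)

def IsSigma (n : ℕ) : Fml → Prop := (levels n).1

def IsPi (n : ℕ) : Fml → Prop := (levels n).2

variable {M N : Type}

/-- `p` is the (Kuratowski) pair `{a, b}` in the sense of `E`. -/
def IsPairOf (E : M → M → Prop) (p a b : M) : Prop :=
  ∀ w, E w p ↔ (w = a ∨ w = b)

/-- `z` is the ordered pair `(a, b)` (Kuratowski) in the sense of `E`. -/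
def IsOPairOf (E : M → M → Prop) (z a b : M) : Prop :=
  ∃ s t, IsPairOf E s a a ∧ IsPairOf E t a b ∧ IsPairOf E z s t

/-- Valuation sending variable 0 to `x` and every other variable to `y`;
used for formulas φ(x, y) with free variables among {0, 1}. -/
def val2 (x y : M) : ℕ → M := fun k => if k = 0 then x else y

/-- Valuation sending 0 ↦ x, 1 ↦ y, everything else ↦ v;
used for formulas φ(x, y, v) with free variables among {0, 1, 2}. -/
def val3 (x y v : M) : ℕ → M := fun k => if k = 0 then x else if k = 1 then y else v

/-- `M ⊨ Sep(φ)` for φ = φ(x, v) (x is variable 0, v is variable 1):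
∀v∀p∃q∀x(x∈q ↔ x∈p ∧ φ(x,v)). -/
def SepAx (E : M → M → Prop) (φ : Fml) : Prop :=
  ∀ v p : M, ∃ q : M, ∀ x : M, E x q ↔ (E x p ∧ Sat E (val2 x v) φ)

/-- `M ⊨ Sep⁻(φ)` for a parameter-free φ = φ(x) (x is variable 0). -/
def SepMinusAx (E : M → M → Prop) (φ : Fml) : Prop :=
  ∀ p : M, ∃ q : M, ∀ x : M, E x q ↔ (E x p ∧ Sat E (fun _ => x) φ)

/-- `(M, E) ⊨ DB₀`: extensionality, empty set, pairing, union, cartesian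
product, and Δ₀ separation. -/
def SatDB0 (E : M → M → Prop) : Prop :=
  (∀ a b : M, (∀ x, E x a ↔ E x b) → a = b) ∧
  (∃ e : M, ∀ x, ¬ E x e) ∧
  (∀ a b : M, ∃ p, IsPairOf E p a b) ∧
  (∀ a : M, ∃ u, ∀ x, E x u ↔ ∃ y, E y a ∧ E x y) ∧
  (∀ a b : M, ∃ c, ∀ z, E z c ↔ ∃ x y, E x a ∧ E y b ∧ IsOPairOf E z x y) ∧
  (∀ φ, IsDelta0 φ → φ.fv ⊆ {0, 1} → SepAx E φ)

/-- `M ⊨ Coll(φ)` for φ = φ(x, y, v) (x = var 0, y = var 1, v = var 2):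
∀v∀p(∀x∈p ∃y φ → ∃q ∀x∈p ∃y∈q φ). -/
def CollAx (E : M → M → Prop) (φ : Fml) : Prop :=
  ∀ v p : M, (∀ x, E x p → ∃ y, Sat E (val3 x y v) φ) →
    ∃ q, ∀ x, E x p → ∃ y, E y q ∧ Sat E (val3 x y v) φ

/-- `M ⊨ Coll_s(φ)`: ∀v∀p∃q∀x∈p(∃y φ ↔ ∃y∈q φ). -/
def CollSAx (E : M → M → Prop) (φ : Fml) : Prop :=
  ∀ v p : M, ∃ q, ∀ x, E x p →
    ((∃ y, Sat E (val3 x y v) φ) ↔ ∃ y, E y q ∧ Sat E (val3 x y v) φ)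

/-- `M ⊨ Coll_w(φ)`: ∀v(∀x∃y φ → ∀p∃q∀x∈p∃y∈q φ). -/
def CollWAx (E : M → M → Prop) (φ : Fml) : Prop :=
  ∀ v : M, (∀ x, ∃ y, Sat E (val3 x y v) φ) →
    ∀ p, ∃ q, ∀ x, E x p → ∃ y, E y q ∧ Sat E (val3 x y v) φ

/-- `M ⊨ Coll⁻(φ)` for a parameter-free φ = φ(x, y) (x = var 0, y = var 1). -/
def CollMinusAx (E : M → M → Prop) (φ : Fml) : Prop :=
  ∀ p : M, (∀ x, E x p → ∃ y, Sat E (val2 x y) φ) →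
    ∃ q, ∀ x, E x p → ∃ y, E y q ∧ Sat E (val2 x y) φ

/-- `M ⊨ Coll_w⁻(φ)` for a parameter-free φ = φ(x, y). -/
def CollWMinusAx (E : M → M → Prop) (φ : Fml) : Prop :=
  (∀ x : M, ∃ y, Sat E (val2 x y) φ) →
    ∀ p, ∃ q, ∀ x, E x p → ∃ y, E y q ∧ Sat E (val2 x y) φ

/-- `M ⊨ Coll_s⁻(φ)` for a parameter-free φ = φ(x, y). -/
def CollSMinusAx (E : M → M → Prop) (φ : Fml) : Prop :=
  ∀ p : M, ∃ q, ∀ x, E x p →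
    ((∃ y, Sat E (val2 x y) φ) ↔ ∃ y, E y q ∧ Sat E (val2 x y) φ)

/- Schemas over a class Γ of formulas. -/

def CollScheme (E : M → M → Prop) (Γ : Fml → Prop) : Prop :=
  ∀ φ, Γ φ → φ.fv ⊆ {0, 1, 2} → CollAx E φ

def CollSScheme (E : M → M → Prop) (Γ : Fml → Prop) : Prop :=
  ∀ φ, Γ φ → φ.fv ⊆ {0, 1, 2} → CollSAx E φ

def CollWScheme (E : M → M → Prop) (Γ : Fml → Prop) : Prop :=
  ∀ φ, Γ φ → φ.fv ⊆ {0, 1, 2} → CollWAx E φ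

def CollMinusScheme (E : M → M → Prop) (Γ : Fml → Prop) : Prop :=
  ∀ φ, Γ φ → φ.fv ⊆ {0, 1} → CollMinusAx E φ

def CollWMinusScheme (E : M → M → Prop) (Γ : Fml → Prop) : Prop :=
  ∀ φ, Γ φ → φ.fv ⊆ {0, 1} → CollWMinusAx E φ

def CollSMinusScheme (E : M → M → Prop) (Γ : Fml → Prop) : Prop :=
  ∀ φ, Γ φ → φ.fv ⊆ {0, 1} → CollSMinusAx E φ

def SepScheme (E : M → M → Prop) (Γ : Fml → Prop) : Prop :=
  ∀ φ, Γ φ → φ.fv ⊆ {0, 1} → SepAx E φ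

def SepMinusScheme (E : M → M → Prop) (Γ : Fml → Prop) : Prop :=
  ∀ φ, Γ φ → φ.fv ⊆ {0} → SepMinusAx E φ

/- Extensions. We present an extension `M ⊆ N` by an embedding `f : M → N`. -/

/-- `f` embeds `(M, EM)` as a substructure of `(N, EN)`. -/
def SubStr (EM : M → M → Prop) (EN : N → N → Prop) (f : M → N) : Prop :=
  Function.Injective f ∧ ∀ a b : M, EM a b ↔ EN (f a) (f b)

/-- `f : M → N` is a (fully) elementary embedding. -/
def ElemEmb (EM : M → M → Prop) (EN : N → N → Prop) (f : M → N) : Prop :=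
  ∀ (φ : Fml) (v : ℕ → M), Sat EM v φ ↔ Sat EN (f ∘ v) φ

/-- `f : M → N` is a Σ_n-elementary embedding (M ≺_{Σ_n} N). -/
def SigmaElemEmb (n : ℕ) (EM : M → M → Prop) (EN : N → N → Prop) (f : M → N) : Prop :=
  ∀ φ, IsSigma n φ → ∀ v : ℕ → M, Sat EM v φ ↔ Sat EN (f ∘ v) φ

/-- `f : M → N` is a Δ₀-elementary embedding (M ≺_{Δ₀} N). -/
def Delta0ElemEmb (EM : M → M → Prop) (EN : N → N → Prop) (f : M → N) : Prop :=
  ∀ φ, IsDelta0 φ → ∀ v : ℕ → M, Sat EM v φ ↔ Sat EN (f ∘ v) φ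

/-- The convex hull M* of (the image of) M in N:
{a ∈ N : N ⊨ a ∈ m for some m ∈ M}. -/
def hull (EN : N → N → Prop) (f : M → N) : Set N := {a | ∃ m : M, EN a (f m)}

/-- The substructure of `N` with domain `S` is a Σ_n-elementary substructure of
`N` (S ≺_{Σ_n} N). -/
def SigmaElemInTop (n : ℕ) (EN : N → N → Prop) (S : Set N) : Prop :=
  ∀ φ, IsSigma n φ → ∀ v : ℕ → N, (∀ k, v k ∈ S) → (SatIn EN S v φ ↔ Sat EN v φ)

/-- The substructure of `N` with domain `S` is a fully elementary substructure. -/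
def ElemInTop (EN : N → N → Prop) (S : Set N) : Prop :=
  ∀ (φ : Fml) (v : ℕ → N), (∀ k, v k ∈ S) → (SatIn EN S v φ ↔ Sat EN v φ)

/-- `f` is a Σ_n-elementary embedding of `M` into the substructure of `N` with
domain `S` (e.g. M ≺_{Σ_n} M*). -/
def SigmaElemEmbInto (n : ℕ) (EM : M → M → Prop) (EN : N → N → Prop) (f : M → N)
    (S : Set N) : Prop :=
  ∀ φ, IsSigma n φ → ∀ v : ℕ → M, Sat EM v φ ↔ SatIn EN S (f ∘ v) φ

/-- `f` is a fully elementary embedding of `M` into the substructure of `N`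
with domain `S`. -/
def ElemEmbInto (EM : M → M → Prop) (EN : N → N → Prop) (f : M → N) (S : Set N) : Prop :=
  ∀ (φ : Fml) (v : ℕ → M), Sat EM v φ ↔ SatIn EN S (f ∘ v) φ

/-- The extension presented by `f` is an end extension. -/
def IsEndEmb (EN : N → N → Prop) (f : M → N) : Prop :=
  ∀ (m : M) (a : N), EN a (f m) → ∃ m', f m' = a

/-- The extension presented by `f` is cofinal. -/
def Cofinal (EN : N → N → Prop) (f : M → N) : Prop :=
  ∀ a : N, ∃ m : M, EN a (f m)

/-- `a` is a transitive set in the sense of `(N, EN)`. -/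
def TransIn (EN : N → N → Prop) (a : N) : Prop :=
  ∀ x, EN x a → ∀ y, EN y x → EN y a

/-- The extension presented by `f` is taller. -/
def Taller (EN : N → N → Prop) (f : M → N) : Prop :=
  ∃ a : N, ∀ m : M, EN (f m) a

/-- The extension presented by `f` is taller*. -/
def TallerStar (EN : N → N → Prop) (f : M → N) : Prop :=
  ∃ a : N, (∀ m : M, EN (f m) a) ∧ TransIn EN a

/-- Property end_n: for every elementary extension N of M, M* ≺_{Σ_n} N. -/
def HasEnd (n : ℕ) (EM : M → M → Prop) : Prop :=
  ∀ (N : Type) (EN : N → N → Prop) (f : M → N), ElemEmb EM EN f →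
    SigmaElemInTop n EN (hull EN f)

/-- Property cof_n: for every elementary extension N of M, M ≺_{Σ_n} M*. -/
def HasCof (n : ℕ) (EM : M → M → Prop) : Prop :=
  ∀ (N : Type) (EN : N → N → Prop) (f : M → N), ElemEmb EM EN f →
    SigmaElemEmbInto n EM EN f (hull EN f)

/-- Property COF_n: for every Δ₀-elementary cofinal extension N of M with
N ⊨ DB₀, M ≺_{Σ_n} N. -/
def HasCOF (n : ℕ) (EM : M → M → Prop) : Prop :=
  ∀ (N : Type) (EN : N → N → Prop) (f : M → N), SatDB0 EN →
    Delta0ElemEmb EM EN f → Cofinal EN f → SigmaElemEmb n EM EN f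

/-- TCo: every set is an element of some transitive set. -/
def SatTCo (E : M → M → Prop) : Prop :=
  ∀ a : M, ∃ t, E a t ∧ TransIn E t

/-- `a` is an ordinal in the sense of `(M, E)`: a transitive set linearly
ordered by `E`. -/
def OrdIn (E : M → M → Prop) (a : M) : Prop :=
  TransIn E a ∧ ∀ x y, E x a → E y a → (E x y ∨ x = y ∨ E y x)

/-- The formula φ(p, α, v) (p = var 0, α = var 1, v = var 2), with parameter
`v ∈ M`, defines a resolution on `(M, E)`. -/
def IsResolution (E : M → M → Prop) (φ : Fml) (v : M) : Prop :=
  φ.fv ⊆ {0, 1, 2} ∧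
  (∀ α, OrdIn E α → ∃! p, Sat E (val3 p α v) φ) ∧
  (∀ α β p q, E α β → Sat E (val3 p α v) φ → Sat E (val3 q β v) φ →
    ∀ x, E x p → E x q) ∧
  (∀ x, ∃ α, OrdIn E α ∧ ∀ p, Sat E (val3 p α v) φ → E x p)

end FOSet

namespace FOSet

open Function

/-! ### Renaming of variables -/

namespace Fml

/-- All variables occurring in a formula, free or bound. -/
def occ : Fml → Finset ℕ
  | mem i j => {i, j}
  | eq i j  => {i, j}
  | not φ   => φ.occ
  | and φ ψ => φ.occ ∪ ψ.occ
  | or φ ψ  => φ.occ ∪ ψ.occ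
  | imp φ ψ => φ.occ ∪ ψ.occ
  | all i φ => insert i φ.occ
  | ex i φ  => insert i φ.occ

/-- Capture-avoiding renaming of the free variables along `σ`. -/
def subst : (ℕ → ℕ) → Fml → Fml
  | σ, mem i j => mem (σ i) (σ j)
  | σ, eq i j  => eq (σ i) (σ j)
  | σ, not φ   => not (subst σ φ)
  | σ, and φ ψ => and (subst σ φ) (subst σ ψ)
  | σ, or φ ψ  => or (subst σ φ) (subst σ ψ)
  | σ, imp φ ψ => imp (subst σ φ) (subst σ ψ)
  | σ, all i φ => all (φ.occ.sup σ + 1) (subst (update σ i (φ.occ.sup σ + 1)) φ)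
  | σ, ex i φ  => ex (φ.occ.sup σ + 1) (subst (update σ i (φ.occ.sup σ + 1)) φ)

lemma fv_subst_subset_range (φ : Fml) : ∀ σ : ℕ → ℕ, (φ.subst σ).fv ⊆ Set.range σ := by
  have key : ∀ (σ : ℕ → ℕ) (i k : ℕ), Set.range (update σ i k) \ {k} ⊆ Set.range σ := by
    rintro σ i k _ ⟨⟨m, rfl⟩, hm⟩
    by_cases h : m = i
    · subst h; simp at hm
    · exact ⟨m, by simp [h]⟩
  induction φ with
  | mem i j => intro σ x hx; rcases hx with rfl | rfl <;> exact ⟨_, rfl⟩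
  | eq i j => intro σ x hx; rcases hx with rfl | rfl <;> exact ⟨_, rfl⟩
  | not φ ih => exact ih
  | and φ ψ h1 h2 => exact fun σ => Set.union_subset (h1 σ) (h2 σ)
  | or φ ψ h1 h2 => exact fun σ => Set.union_subset (h1 σ) (h2 σ)
  | imp φ ψ h1 h2 => exact fun σ => Set.union_subset (h1 σ) (h2 σ)
  | all i φ ih => exact fun σ x hx => key _ _ _ ⟨ih _ hx.1, hx.2⟩
  | ex i φ ih => exact fun σ x hx => key _ _ _ ⟨ih _ hx.1, hx.2⟩

end Fml

section Satisfaction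

variable {K : Type} {E : K → K → Prop}

@[simp] lemma sat_mem {v : ℕ → K} {i j} : Sat E v (.mem i j) ↔ E (v i) (v j) := Iff.rfl
@[simp] lemma sat_eq {v : ℕ → K} {i j} : Sat E v (.eq i j) ↔ v i = v j := Iff.rfl
@[simp] lemma sat_not {v : ℕ → K} {φ} : Sat E v (.not φ) ↔ ¬ Sat E v φ := Iff.rfl
@[simp] lemma sat_and {v : ℕ → K} {φ ψ} :
    Sat E v (.and φ ψ) ↔ Sat E v φ ∧ Sat E v ψ := Iff.rfl
@[simp] lemma sat_or {v : ℕ → K} {φ ψ} :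
    Sat E v (.or φ ψ) ↔ Sat E v φ ∨ Sat E v ψ := Iff.rfl
@[simp] lemma sat_imp {v : ℕ → K} {φ ψ} :
    Sat E v (.imp φ ψ) ↔ (Sat E v φ → Sat E v ψ) := Iff.rfl
@[simp] lemma sat_all {v : ℕ → K} {i φ} :
    Sat E v (.all i φ) ↔ ∀ a, Sat E (update v i a) φ := by simp [Sat, SatIn]
@[simp] lemma sat_ex {v : ℕ → K} {i φ} :
    Sat E v (.ex i φ) ↔ ∃ a, Sat E (update v i a) φ := by simp [Sat, SatIn]

lemma sat_congr (φ : Fml) : ∀ {v w : ℕ → K}, (∀ k ∈ φ.occ, v k = w k) →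
    (Sat E v φ ↔ Sat E w φ) := by
  induction φ with
  | mem i j => intro v w h; simp [Fml.occ] at h; simp [h]
  | eq i j => intro v w h; simp [Fml.occ] at h; simp [h]
  | not φ ih => intro v w h; simp [ih h]
  | and φ ψ h1 h2 =>
    intro v w h; simp only [Fml.occ, Finset.mem_union] at h
    simp [h1 fun k hk => h k (.inl hk), h2 fun k hk => h k (.inr hk)]
  | or φ ψ h1 h2 =>
    intro v w h; simp only [Fml.occ, Finset.mem_union] at h
    simp [h1 fun k hk => h k (.inl hk), h2 fun k hk => h k (.inr hk)]
  | imp φ ψ h1 h2 =>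
    intro v w h; simp only [Fml.occ, Finset.mem_union] at h
    simp [h1 fun k hk => h k (.inl hk), h2 fun k hk => h k (.inr hk)]
  | all i φ ih =>
    intro v w h; simp only [Fml.occ, Finset.mem_insert] at h
    simp only [sat_all]
    refine forall_congr' fun a => ih fun k hk => ?_
    by_cases hki : k = i
    · subst hki; simp
    · simp [hki, h k (.inr hk)]
  | ex i φ ih =>
    intro v w h; simp only [Fml.occ, Finset.mem_insert] at h
    simp only [sat_ex]
    refine exists_congr fun a => ih fun k hk => ?_
    by_cases hki : k = i
    · subst hki; simp
    · simp [hki, h k (.inr hk)]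

lemma update_comp_update_of_fresh {φ : Fml} {σ : ℕ → ℕ} (v : ℕ → K) (i : ℕ) (a : K) :
    ∀ m ∈ φ.occ, (update v (φ.occ.sup σ + 1) a ∘ update σ i (φ.occ.sup σ + 1)) m
      = update (v ∘ σ) i a m := by
  intro m hm
  by_cases h : m = i
  · subst h; simp
  · have : σ m ≤ φ.occ.sup σ := Finset.le_sup hm
    have : σ m ≠ φ.occ.sup σ + 1 := by omega
    simp [h, this]

lemma sat_subst (φ : Fml) : ∀ {σ : ℕ → ℕ} {v : ℕ → K},
    Sat E v (φ.subst σ) ↔ Sat E (v ∘ σ) φ := by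
  induction φ with
  | mem i j => simp [Fml.subst]
  | eq i j => simp [Fml.subst]
  | not φ ih => simp [Fml.subst, ih]
  | and φ ψ h1 h2 => simp [Fml.subst, h1, h2]
  | or φ ψ h1 h2 => simp [Fml.subst, h1, h2]
  | imp φ ψ h1 h2 => simp [Fml.subst, h1, h2]
  | all i φ ih =>
    intro σ v
    simp only [Fml.subst, sat_all, ih]
    exact forall_congr' fun a => sat_congr φ (update_comp_update_of_fresh v i a)
  | ex i φ ih =>
    intro σ v
    simp only [Fml.subst, sat_ex, ih]
    exact exists_congr fun a => sat_congr φ (update_comp_update_of_fresh v i a)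

end Satisfaction

lemma IsDelta0.subst {φ : Fml} (h : IsDelta0 φ) : ∀ σ, IsDelta0 (φ.subst σ) := by
  have key : ∀ (σ : ℕ → ℕ) (s : Finset ℕ) (j : ℕ), j ∈ s → s.sup σ + 1 ≠ σ j := by
    intro σ s j hj
    have : σ j ≤ s.sup σ := Finset.le_sup hj
    omega
  induction h with
  | mem i j => exact fun σ => .mem _ _
  | eq i j => exact fun σ => .eq _ _
  | not _ ih => exact fun σ => .not (ih σ)
  | and _ _ h1 h2 => exact fun σ => .and (h1 σ) (h2 σ)
  | or _ _ h1 h2 => exact fun σ => .or (h1 σ) (h2 σ)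
  | imp _ _ h1 h2 => exact fun σ => .imp (h1 σ) (h2 σ)
  | ball hij _ ih =>
    intro σ
    simp only [Fml.subst, update_self, update_of_ne hij.symm]
    exact .ball (key _ _ _ (by simp [Fml.occ])) (ih _)
  | bex hij _ ih =>
    intro σ
    simp only [Fml.subst, update_self, update_of_ne hij.symm]
    exact .bex (key _ _ _ (by simp [Fml.occ])) (ih _)

lemma levels_subst (n : ℕ) : ∀ φ σ, (IsSigma n φ → IsSigma n (φ.subst σ)) ∧
    (IsPi n φ → IsPi n (φ.subst σ)) := by
  induction n with
  | zero => exact fun φ σ => ⟨fun h => IsDelta0.subst h σ, fun h => IsDelta0.subst h σ⟩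
  | succ n ih =>
    intro φ σ
    constructor
    · rintro ⟨i, ψ, hψ, rfl⟩
      exact ⟨_, _, (ih ψ _).2 hψ, rfl⟩
    · rintro ⟨i, ψ, hψ, rfl⟩
      exact ⟨_, _, (ih ψ _).1 hψ, rfl⟩

/-! ### Relations uniformly definable over a class of structures -/

/-- Prepend a value to a valuation. -/
def vcons {K : Type} (a : K) (v : ℕ → K) : ℕ → K
  | 0 => a
  | k + 1 => v k

@[simp] lemma vcons_zero {K : Type} (a : K) (v : ℕ → K) : vcons a v 0 = a := rfl
@[simp] lemma vcons_succ {K : Type} (a : K) (v : ℕ → K) (k : ℕ) :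
    vcons a v (k + 1) = v k := rfl
@[simp] lemma vcons_one {K : Type} (a : K) (v : ℕ → K) : vcons a v 1 = v 0 := rfl
@[simp] lemma vcons_two {K : Type} (a : K) (v : ℕ → K) : vcons a v 2 = v 1 := rfl
@[simp] lemma vcons_three {K : Type} (a : K) (v : ℕ → K) : vcons a v 3 = v 2 := rfl
@[simp] lemma vcons_four {K : Type} (a : K) (v : ℕ → K) : vcons a v 4 = v 3 := rfl

lemma comp_vcons {K L : Type} (f : K → L) (a : K) (v : ℕ → K) :
    f ∘ vcons a v = vcons (f a) (f ∘ v) := by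
  funext k; cases k <;> rfl

/-- Structures for the language with one binary relation. -/
abbrev Str := Σ K : Type, K → K → Prop

/-- Families of relations on the valuations of all structures. -/
abbrev Rel := ∀ S : Str, (ℕ → S.1) → Prop

/-- `R` is uniformly Σ_n-definable over the structures in the class `C`. -/
def DefS (C : Str → Prop) : ℕ → Rel → Prop
  | 0, R => ∃ φ, IsDelta0 φ ∧ ∀ S, C S → ∀ v, R S v ↔ Sat S.2 v φ
  | n + 1, R => ∃ Q, DefS C n Q ∧ ∀ S, C S → ∀ v, R S v ↔ ∃ a, ¬ Q S (vcons a v)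

section Definability

variable {C : Str → Prop}

lemma DefS.congr {n : ℕ} {R R' : Rel} (h : DefS C n R)
    (e : ∀ S, C S → ∀ v, R' S v ↔ R S v) : DefS C n R' := by
  cases n with
  | zero => obtain ⟨φ, hφ, h⟩ := h; exact ⟨φ, hφ, fun S hS v => (e S hS v).trans (h S hS v)⟩
  | succ n => obtain ⟨Q, hQ, h⟩ := h; exact ⟨Q, hQ, fun S hS v => (e S hS v).trans (h S hS v)⟩

lemma DefS.subst {n : ℕ} : ∀ {R : Rel}, DefS C n R → ∀ σ : ℕ → ℕ,
    DefS C n (fun S v => R S (v ∘ σ)) := by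
  induction n with
  | zero =>
    rintro R ⟨φ, hφ, h⟩ σ
    exact ⟨φ.subst σ, hφ.subst σ, fun S hS v => (h S hS _).trans (sat_subst φ).symm⟩
  | succ n ih =>
    rintro R ⟨Q, hQ, h⟩ σ
    refine ⟨_, ih hQ (vcons 0 (fun k => σ k + 1)), fun S hS v => (h S hS _).trans ?_⟩
    refine exists_congr fun a => ?_
    have : vcons a v ∘ vcons 0 (fun k => σ k + 1) = vcons a (v ∘ σ) := by
      funext k; cases k <;> rfl
    rw [this]

lemma defS_mem (i j : ℕ) : DefS C 0 (fun S v => S.2 (v i) (v j)) :=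
  ⟨_, .mem i j, fun _ _ _ => Iff.rfl⟩

lemma defS_eq (i j : ℕ) : DefS C 0 (fun _ v => v i = v j) :=
  ⟨_, .eq i j, fun _ _ _ => Iff.rfl⟩

lemma DefS.not_zero {R : Rel} (h : DefS C 0 R) : DefS C 0 (fun S v => ¬ R S v) := by
  obtain ⟨φ, hφ, h⟩ := h
  exact ⟨_, hφ.not, fun S hS v => not_congr (h S hS v)⟩

lemma DefS.and_zero {R T : Rel} (h : DefS C 0 R) (h' : DefS C 0 T) :
    DefS C 0 (fun S v => R S v ∧ T S v) := by
  obtain ⟨φ, hφ, h⟩ := h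
  obtain ⟨ψ, hψ, h'⟩ := h'
  exact ⟨_, hφ.and hψ, fun S hS v => and_congr (h S hS v) (h' S hS v)⟩

lemma DefS.or_zero {R T : Rel} (h : DefS C 0 R) (h' : DefS C 0 T) :
    DefS C 0 (fun S v => R S v ∨ T S v) := by
  obtain ⟨φ, hφ, h⟩ := h
  obtain ⟨ψ, hψ, h'⟩ := h'
  exact ⟨_, hφ.or hψ, fun S hS v => or_congr (h S hS v) (h' S hS v)⟩

/-- The value at the head of the valuation can be assigned to a fresh named variable. -/
lemma exists_fresh_subst (φ : Fml) (j : ℕ) : ∃ (k : ℕ) (σ : ℕ → ℕ), k ≠ j ∧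
    ∀ (K : Type) (E : K → K → Prop) (v : ℕ → K) (a : K),
      Sat E (update v k a) (φ.subst σ) ↔ Sat E (vcons a v) φ := by
  refine ⟨φ.occ.sup id + j + 1, vcons (φ.occ.sup id + j + 1) id, by omega, ?_⟩
  intro K E v a
  rw [sat_subst]
  refine sat_congr φ fun m hm => ?_
  cases m with
  | zero => simp
  | succ m =>
    have : m + 1 ≤ φ.occ.sup id := Finset.le_sup (f := id) hm
    have : m ≠ φ.occ.sup id + j + 1 := by omega
    simp [this]

lemma DefS.bex_zero {R : Rel} (h : DefS C 0 R) (j : ℕ) :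
    DefS C 0 (fun S v => ∃ a, S.2 a (v j) ∧ R S (vcons a v)) := by
  obtain ⟨φ, hφ, h⟩ := h
  obtain ⟨k, σ, hk, hσ⟩ := exists_fresh_subst φ j
  refine ⟨_, .bex hk (hφ.subst σ), fun S hS v => ?_⟩
  simp [hσ, h S hS, hk.symm]

lemma DefS.ball_zero {R : Rel} (h : DefS C 0 R) (j : ℕ) :
    DefS C 0 (fun S v => ∀ a, S.2 a (v j) → R S (vcons a v)) :=
  (h.not_zero.bex_zero j).not_zero.congr fun S hS v => by simp

lemma update_eq_vcons_comp {K : Type} (v : ℕ → K) (i : ℕ) (a : K) :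
    update v i a = vcons a v ∘ (fun m => if m = i then 0 else m + 1) := by
  funext m
  by_cases h : m = i <;> simp [h]

lemma defS_of_level (n : ℕ) : ∀ φ,
    (IsSigma n φ → DefS C n (fun S v => Sat S.2 v φ)) ∧
    (IsPi n φ → DefS C n (fun S v => ¬ Sat S.2 v φ)) := by
  induction n with
  | zero =>
    exact fun φ => ⟨fun h => ⟨φ, h, fun _ _ _ => Iff.rfl⟩,
      fun h => ⟨φ.not, h.not, fun _ _ _ => Iff.rfl⟩⟩
  | succ n ih =>
    intro φ
    constructor
    · rintro ⟨i, ψ, hψ, rfl⟩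
      refine ⟨_, ((ih ψ).2 hψ).subst (fun m => if m = i then 0 else m + 1), fun S _ v => ?_⟩
      simp [← update_eq_vcons_comp]
    · rintro ⟨i, ψ, hψ, rfl⟩
      refine ⟨_, ((ih ψ).1 hψ).subst (fun m => if m = i then 0 else m + 1), fun S _ v => ?_⟩
      simp [← update_eq_vcons_comp]

lemma DefS.exists_level {n : ℕ} : ∀ {R : Rel}, DefS C n R →
    (∃ φ, IsSigma n φ ∧ ∀ S, C S → ∀ v, R S v ↔ Sat S.2 v φ) ∧
    (∃ φ, IsPi n φ ∧ ∀ S, C S → ∀ v, R S v ↔ ¬ Sat S.2 v φ) := by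
  induction n with
  | zero =>
    rintro R ⟨φ, hφ, h⟩
    exact ⟨⟨φ, hφ, h⟩, φ.not, hφ.not, fun S hS v => by simp [h S hS v]⟩
  | succ n ih =>
    rintro R ⟨Q, hQ, h⟩
    obtain ⟨⟨φ, hφ, h1⟩, ψ, hψ, h2⟩ := ih hQ
    constructor
    · obtain ⟨k, σ, -, hσ⟩ := exists_fresh_subst ψ 0
      refine ⟨_, ⟨k, _, (levels_subst n ψ σ).2 hψ, rfl⟩, fun S hS v => ?_⟩
      simp [h S hS v, hσ, h2 S hS]
    · obtain ⟨k, σ, -, hσ⟩ := exists_fresh_subst φ 0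
      refine ⟨_, ⟨k, _, (levels_subst n φ σ).1 hφ, rfl⟩, fun S hS v => ?_⟩
      simp [h S hS v, hσ, h1 S hS]

lemma DefS.finite_support {n : ℕ} : ∀ {R : Rel}, DefS C n R → ∃ r, ∀ S, C S → ∀ v w,
    (∀ k ≤ r, v k = w k) → (R S v ↔ R S w) := by
  induction n with
  | zero =>
    rintro R ⟨φ, -, h⟩
    refine ⟨φ.occ.sup id, fun S hS v w e => ?_⟩
    rw [h S hS, h S hS]
    exact sat_congr φ fun k hk => e k (Finset.le_sup (f := id) hk)
  | succ n ih =>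
    rintro R ⟨Q, hQ, h⟩
    obtain ⟨r, hr⟩ := ih hQ
    refine ⟨r, fun S hS v w e => ?_⟩
    rw [h S hS, h S hS]
    refine exists_congr fun a => not_congr (hr S hS _ _ fun k hk => ?_)
    cases k with
    | zero => rfl
    | succ k => exact e k (by omega)

lemma DefS.not_succ {n : ℕ} {R : Rel} (hC : ∀ S, C S → SatDB0 S.2) (h : DefS C n R) :
    DefS C (n + 1) (fun S v => ¬ R S v) := by
  refine ⟨_, h.subst Nat.succ, fun S hS v => ?_⟩
  obtain ⟨e, -⟩ := (hC S hS).2.1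
  exact ⟨fun h => ⟨e, h⟩, fun ⟨_, h⟩ => h⟩

lemma DefS.succ {n : ℕ} (hC : ∀ S, C S → SatDB0 S.2) : ∀ {R : Rel}, DefS C n R →
    DefS C (n + 1) R := by
  induction n with
  | zero =>
    intro R h
    exact (h.not_zero.not_succ hC).congr fun S hS v => by simp
  | succ n ih =>
    rintro R ⟨Q, hQ, h⟩
    exact ⟨Q, ih hQ, h⟩

lemma DefS.of_zero {n : ℕ} (hC : ∀ S, C S → SatDB0 S.2) {R : Rel} (h : DefS C 0 R) :
    DefS C n R := by
  induction n with
  | zero => exact h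
  | succ n ih => exact ih.succ hC

/-! ### Contracting quantifiers and parameters with ordered pairs -/

lemma isOPairOf_iff {K : Type} {E : K → K → Prop} {w a b : K} : IsOPairOf E w a b ↔
    ∃ s, E s w ∧ E a s ∧ (∀ y, E y s → y = a) ∧ ∃ t, E t w ∧ E b t ∧ E a t ∧
      (∀ y, E y t → (y = a ∨ y = b)) ∧ ∀ y, E y w → (y = s ∨ y = t) := by
  constructor
  · rintro ⟨s, t, hs, ht, hw⟩
    exact ⟨s, (hw s).2 (.inl rfl), (hs a).2 (.inl rfl), fun y hy => by simpa using (hs y).1 hy,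
      t, (hw t).2 (.inr rfl), (ht b).2 (.inr rfl), (ht a).2 (.inl rfl),
      fun y => (ht y).1, fun y => (hw y).1⟩
  · rintro ⟨s, hs, has, hs', t, ht, hbt, hat, ht', hw⟩
    refine ⟨s, t, fun y => ⟨fun hy => .inl (hs' y hy), ?_⟩, fun y => ⟨ht' y, ?_⟩,
      fun y => ⟨hw y, ?_⟩⟩
    · rintro (rfl | rfl) <;> assumption
    · rintro (rfl | rfl) <;> assumption
    · rintro (rfl | rfl) <;> assumption

lemma IsOPairOf.inj {K : Type} {E : K → K → Prop} {w a b a' b' : K}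
    (h : IsOPairOf E w a b) (h' : IsOPairOf E w a' b') : a = a' ∧ b = b' := by
  obtain ⟨s, t, hs, ht, hw⟩ := h
  obtain ⟨s', t', hs', ht', hw'⟩ := h'
  have e1 := (hw s').1 ((hw' s').2 (.inl rfl))
  have e2 := (hw t').1 ((hw' t').2 (.inr rfl))
  have e3 := (hw' t).1 ((hw t).2 (.inr rfl))
  have ha : a = a' := by
    have : E a s' := by
      rcases e1 with rfl | rfl
      · exact (hs a).2 (.inl rfl)
      · exact (ht a).2 (.inl rfl)
    simpa using (hs' a).1 this
  subst ha
  refine ⟨rfl, ?_⟩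
  have hb : b = a ∨ b = b' := by
    have hbt : E b t := (ht b).2 (.inr rfl)
    rcases e3 with rfl | rfl
    · exact .inl (by simpa using (hs' b).1 hbt)
    · exact (ht' b).1 hbt
  have hb' : b' = a ∨ b' = b := by
    have hbt : E b' t' := (ht' b').2 (.inr rfl)
    rcases e2 with rfl | rfl
    · exact .inl (by simpa using (hs b').1 hbt)
    · exact (ht b').1 hbt
  grind

lemma SatDB0.exists_opair {K : Type} {E : K → K → Prop} (h : SatDB0 E) (a b : K) :
    ∃ w, IsOPairOf E w a b := by
  obtain ⟨s, hs⟩ := h.2.2.1 a a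
  obtain ⟨t, ht⟩ := h.2.2.1 a b
  obtain ⟨w, hw⟩ := h.2.2.1 s t
  exact ⟨w, s, t, hs, ht, hw⟩

lemma DefS.exists_opair_zero {R : Rel} (h : DefS C 0 R) :
    DefS C 0 (fun S v => ∃ a b, IsOPairOf S.2 (v 0) a b ∧
      R S (vcons a (vcons b (fun k => v (k + 1))))) := by
  have hR := h.subst (vcons 2 (vcons 0 (fun k => k + 5)))
  have h1 : DefS C 0 (fun S v => ∀ y, S.2 y (v 1) → (y = v 0)) := (defS_eq 0 1).ball_zero 1
  have h2 : DefS C 0 (fun S v => ∀ y, S.2 y (v 1) → (y = v 2 ∨ y = v 0)) :=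
    ((defS_eq 0 3).or_zero (defS_eq 0 1)).ball_zero 1
  have h3 : DefS C 0 (fun S v => ∀ y, S.2 y (v 4) → (y = v 3 ∨ y = v 1)) :=
    ((defS_eq 0 4).or_zero (defS_eq 0 2)).ball_zero 4
  have h4 := ((defS_mem 2 1).and_zero (h2.and_zero (h3.and_zero hR))).bex_zero 0
  refine ((h1.and_zero (h4.bex_zero 2)).bex_zero 0 |>.bex_zero 0).congr fun S hS v => ?_
  have e : ∀ s a t b, (vcons b (vcons t (vcons a (vcons s v)))) ∘
      (vcons 2 (vcons 0 (fun k => k + 5))) = vcons a (vcons b (fun k => v (k + 1))) := by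
    intro s a t b
    funext k
    rcases k with _ | _ | k <;> rfl
  simp only [isOPairOf_iff, e, vcons_zero, vcons_one, vcons_two, vcons_three, vcons_four]
  constructor
  · rintro ⟨a, b, ⟨s, h1, h2, h3, t, h4, h5, h6, h7, h8⟩, h9⟩
    exact ⟨s, h1, a, h2, h3, t, h4, b, h5, h6, h7, h8, h9⟩
  · rintro ⟨s, h1, a, h2, h3, t, h4, b, h5, h6, h7, h8, h9⟩
    exact ⟨a, b, ⟨s, h1, h2, h3, t, h4, h5, h6, h7, h8⟩, h9⟩

/-- Two leading arguments can be merged into one ordered pair; `d` prescribes the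
truth value at arguments that are not ordered pairs. -/
lemma DefS.merge (hC : ∀ S, C S → SatDB0 S.2) {n : ℕ} : ∀ {R : Rel}, DefS C n R →
    ∀ d : Prop, ∃ R', DefS C n R' ∧ ∀ S, C S → ∀ w v,
      (∀ a b, IsOPairOf S.2 w a b → (R' S (vcons w v) ↔ R S (vcons a (vcons b v)))) ∧
      ((¬ ∃ a b, IsOPairOf S.2 w a b) → (R' S (vcons w v) ↔ d)) := by
  induction n with
  | zero =>
    intro R h d
    by_cases hd : d
    · refine ⟨_, h.not_zero.exists_opair_zero.not_zero, fun S hS w v => ⟨?_, ?_⟩⟩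
      · intro a b hab
        refine ⟨fun h' => by_contra fun hn => h' ⟨a, b, hab, hn⟩, ?_⟩
        rintro hR ⟨a', b', hab', hn⟩
        obtain ⟨rfl, rfl⟩ := hab.inj hab'
        exact hn hR
      · intro hw
        refine iff_of_true ?_ hd
        rintro ⟨a, b, hab, -⟩
        exact hw ⟨a, b, hab⟩
    · refine ⟨_, h.exists_opair_zero, fun S hS w v => ⟨?_, ?_⟩⟩
      · intro a b hab
        refine ⟨?_, fun h' => ⟨a, b, hab, h'⟩⟩
        rintro ⟨a', b', hab', hR⟩
        obtain ⟨rfl, rfl⟩ := hab.inj hab'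
        exact hR
      · intro hw
        refine iff_of_false ?_ hd
        rintro ⟨a, b, hab, -⟩
        exact hw ⟨a, b, hab⟩
  | succ n ih =>
    rintro R ⟨Q, hQ, h⟩ d
    obtain ⟨Q', hQ', h'⟩ := ih (hQ.subst (vcons 2 (vcons 0 (vcons 1 (fun k => k + 3))))) (¬ d)
    refine ⟨fun S v => ∃ c, ¬ Q' S (vcons (v 0) (vcons c (fun k => v (k + 1)))),
      ⟨_, hQ'.subst (vcons 1 (vcons 0 (fun k => k + 2))), fun S hS v => ?_⟩,
      fun S hS w v => ⟨fun a b hab => ?_, fun hw => ?_⟩⟩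
    · refine exists_congr fun c => ?_
      have : vcons c v ∘ vcons 1 (vcons 0 (fun k => k + 2)) =
          vcons (v 0) (vcons c (fun k => v (k + 1))) := by
        funext k; rcases k with _ | _ | k <;> rfl
      rw [this]
    · rw [h S hS]
      refine exists_congr fun c => not_congr (((h' S hS _ _).1 a b hab).trans ?_)
      have : vcons a (vcons b (vcons c fun k => vcons w v (k + 1))) ∘
          vcons 2 (vcons 0 (vcons 1 (fun k => k + 3))) = vcons c (vcons a (vcons b v)) := by
        funext k; rcases k with _ | _ | _ | k <;> rfl
      rw [this]
    · obtain ⟨e, -⟩ := (hC S hS).2.1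
      simp only [(h' S hS _ _).2 hw, vcons_zero, not_not]
      exact ⟨fun ⟨_, h⟩ => h, fun h => ⟨e, h⟩⟩

lemma DefS.ex_succ (hC : ∀ S, C S → SatDB0 S.2) {n : ℕ} {R : Rel} (h : DefS C (n + 1) R) :
    DefS C (n + 1) (fun S v => ∃ a, R S (vcons a v)) := by
  obtain ⟨Q, hQ, h⟩ := h
  obtain ⟨Q', hQ', h'⟩ := hQ.merge hC True
  refine ⟨Q', hQ', fun S hS v => ?_⟩
  simp only [h S hS]
  constructor
  · rintro ⟨a, b, hab⟩
    obtain ⟨w, hw⟩ := (hC S hS).exists_opair b a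
    exact ⟨w, by rwa [(h' S hS w v).1 b a hw]⟩
  · rintro ⟨w, hw⟩
    by_cases hp : ∃ a b, IsOPairOf S.2 w a b
    · obtain ⟨b, a, hp⟩ := hp
      exact ⟨a, b, by rwa [← (h' S hS w v).1 b a hp]⟩
    · exact absurd trivial (by rwa [(h' S hS w v).2 hp] at hw)

lemma DefS.and_or (hC : ∀ S, C S → SatDB0 S.2) {n : ℕ} : ∀ {R T : Rel},
    DefS C n R → DefS C n T →
    DefS C n (fun S v => R S v ∧ T S v) ∧ DefS C n (fun S v => R S v ∨ T S v) := by
  induction n with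
  | zero => exact fun h h' => ⟨h.and_zero h', h.or_zero h'⟩
  | succ n ih =>
    rintro R T ⟨Q, hQ, h⟩ ⟨P, hP, h'⟩
    constructor
    · have h1 : DefS C (n + 1) _ :=
        ⟨_, (ih (hQ.subst (vcons 1 (fun k => k + 2))) (hP.subst (vcons 0 (fun k => k + 2)))).2,
          fun S hS v => Iff.rfl⟩
      refine (h1.ex_succ hC).congr fun S hS v => ?_
      have e1 : ∀ a b : S.1, vcons b (vcons a v) ∘ vcons 1 (fun k => k + 2) = vcons a v := by
        intro a b; funext k; cases k <;> rfl
      have e2 : ∀ a b : S.1, vcons b (vcons a v) ∘ vcons 0 (fun k => k + 2) = vcons b v := by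
        intro a b; funext k; cases k <;> rfl
      simp only [h S hS, h' S hS, e1, e2, not_or]
      exact ⟨fun ⟨⟨a, ha⟩, b, hb⟩ => ⟨a, b, ha, hb⟩, fun ⟨a, b, ha, hb⟩ => ⟨⟨a, ha⟩, b, hb⟩⟩
    · refine ⟨_, (ih hQ hP).1, fun S hS v => ?_⟩
      simp only [h S hS, h' S hS, not_and_or, exists_or]

/-! ### Collection with arbitrary parameters -/

/-- Finitely supported parameters can be coded by a single parameter. -/
lemma DefS.exists_val3 (hC : ∀ S, C S → SatDB0 S.2) {n : ℕ} {S : Str} (hS : C S) :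
    ∀ (r : ℕ) {R : Rel}, DefS C n R → ∀ v : ℕ → S.1, (∀ j ≥ r, v j = v r) →
    ∃ R' w, DefS C n R' ∧ ∀ x y, R S (vcons y (vcons x v)) ↔ R' S (val3 x y w) := by
  intro r
  induction r with
  | zero =>
    intro R hR v hv
    refine ⟨_, v 0, hR.subst (vcons 1 (vcons 0 (fun k => k + 2))), fun x y => ?_⟩
    have : val3 x y (v 0) ∘ vcons 1 (vcons 0 (fun k => k + 2)) = vcons y (vcons x v) := by
      funext k
      rcases k with _ | _ | k
      · rfl
      · rfl
      · exact (hv k (Nat.zero_le k)).symm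
    rw [this]
  | succ r ih =>
    intro R hR v hv
    obtain ⟨w, hw⟩ := (hC S hS).exists_opair (v 0) (v 1)
    rcases r with _ | r
    · obtain ⟨R', hR', h'⟩ := (hR.subst (vcons 2 (vcons 3 (vcons 0 (fun _ => 1))))).merge hC True
      refine ⟨_, w, hR'.subst (vcons 2 (vcons 1 (vcons 0 (fun _ => 2)))), fun x y => ?_⟩
      have e1 : val3 x y w ∘ vcons 2 (vcons 1 (vcons 0 (fun _ => 2))) =
          vcons w (vcons y (vcons x fun _ => w)) := by
        funext k; rcases k with _ | _ | _ | k <;> rfl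
      have e2 : vcons (v 0) (vcons (v 1) (vcons y (vcons x fun _ => w))) ∘
          vcons 2 (vcons 3 (vcons 0 (fun _ => 1))) = vcons y (vcons x v) := by
        funext k
        rcases k with _ | _ | _ | k
        · rfl
        · rfl
        · rfl
        · exact (hv (k + 1) (by omega)).symm
      rw [e1, (h' S hS _ _).1 _ _ hw, e2]
    · obtain ⟨R', hR', h'⟩ := (hR.subst
        (vcons 2 (vcons 3 (vcons 0 (vcons 1 (fun k => k + 4)))))).merge hC True
      obtain ⟨R₂, w₂, hR₂, h₂⟩ := ih (hR'.subst (vcons 2 (vcons 0 (vcons 1 (fun k => k + 3)))))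
        (vcons w (fun k => v (k + 2))) (by
          intro j hj
          obtain ⟨j, rfl⟩ : ∃ i, j = i + 1 := ⟨j - 1, by omega⟩
          simp only [vcons_succ]
          rw [hv (j + 2) (by omega), hv (r + 2) (by omega)])
      refine ⟨R₂, w₂, hR₂, fun x y => (Iff.trans ?_ (h₂ x y))⟩
      have e1 : vcons y (vcons x (vcons w fun k => v (k + 2))) ∘
          vcons 2 (vcons 0 (vcons 1 (fun k => k + 3))) =
          vcons w (vcons y (vcons x fun k => v (k + 2))) := by
        funext k; rcases k with _ | _ | _ | k <;> rfl
      have e2 : vcons (v 0) (vcons (v 1) (vcons y (vcons x fun k => v (k + 2)))) ∘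
          vcons 2 (vcons 3 (vcons 0 (vcons 1 (fun k => k + 4)))) = vcons y (vcons x v) := by
        funext k; rcases k with _ | _ | _ | _ | k <;> rfl
      rw [e1, (h' S hS _ _).1 _ _ hw, e2]

/-- Collection for the relation `R`, read as `R(y, x, v)`. -/
def CollRel (S : Str) (R : Rel) : Prop :=
  ∀ v p, (∀ x, S.2 x p → ∃ y, R S (vcons y (vcons x v))) →
    ∃ q, ∀ x, S.2 x p → ∃ y, S.2 y q ∧ R S (vcons y (vcons x v))

lemma val3_comp_min {K : Type} (x y w : K) : val3 x y w ∘ (fun k => min k 2) = val3 x y w := by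
  funext k
  rcases k with _ | _ | k <;> simp [val3]

lemma Fml.fv_subst_min (φ : Fml) : (φ.subst (fun k => min k 2)).fv ⊆ {0, 1, 2} := by
  refine (φ.fv_subst_subset_range _).trans ?_
  rintro _ ⟨k, rfl⟩
  simp only [Set.mem_insert_iff, Set.mem_singleton_iff]
  omega

lemma CollScheme.collRel (hC : ∀ S, C S → SatDB0 S.2) {k : ℕ} {S : Str} (hS : C S)
    (h : CollScheme S.2 (IsSigma k)) {R : Rel} (hR : DefS C k R) : CollRel S R := by
  intro v p
  obtain ⟨r, hr⟩ := hR.finite_support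
  obtain ⟨R', w, hR', e⟩ := hR.exists_val3 hC hS r (fun j => v (min j r))
    (fun j hj => by simp [min_eq_right hj])
  obtain ⟨⟨φ, hφ, hφR⟩, -⟩ := hR'.exists_level
  have key : ∀ x y, R S (vcons y (vcons x v)) ↔
      Sat S.2 (val3 x y w) (φ.subst (fun k => min k 2)) := by
    intro x y
    rw [sat_subst, val3_comp_min, ← hφR S hS, ← e]
    refine hr S hS _ _ fun k hk => ?_
    rcases k with _ | _ | k
    · rfl
    · rfl
    · have : min k r = k := by omega
      simp [this]
  simp only [key]
  exact h _ ((levels_subst k φ _).1 hφ) φ.fv_subst_min w p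

lemma DefS.bex_succ (hC : ∀ S, C S → SatDB0 S.2) {n : ℕ} {R : Rel} (h : DefS C (n + 1) R)
    (j : ℕ) : DefS C (n + 1) (fun S v => ∃ a, S.2 a (v j) ∧ R S (vcons a v)) :=
  (((defS_mem 0 (j + 1)).of_zero hC).and_or hC h).1.ex_succ hC

lemma DefS.bex (hC : ∀ S, C S → SatDB0 S.2) {n : ℕ} {R : Rel} (h : DefS C n R) (j : ℕ) :
    DefS C n (fun S v => ∃ a, S.2 a (v j) ∧ R S (vcons a v)) := by
  cases n with
  | zero => exact h.bex_zero j
  | succ n => exact h.bex_succ hC j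

lemma DefS.ball (hC : ∀ S, C S → SatDB0 S.2) {n : ℕ} :
    ∀ (_ : ∀ k < n, ∀ Q, DefS C k Q → ∀ S, C S → CollRel S (fun S v => ¬ Q S v))
      {R : Rel} (_ : DefS C n R) (j : ℕ),
      DefS C n (fun S v => ∀ a, S.2 a (v j) → R S (vcons a v)) := by
  induction n with
  | zero => exact fun _ R h j => h.ball_zero j
  | succ n ih =>
    rintro hcoll R ⟨Q, hQ, h⟩ j
    have hQ' := hQ.subst (vcons 0 (vcons 1 (fun k => k + 3)))
    refine ⟨_, (ih (fun k hk => hcoll k (by omega)) hQ' 1).bex hC (j + 1), fun S hS v => ?_⟩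
    have e : ∀ q x y : S.1, vcons y (vcons x (vcons q v)) ∘ vcons 0 (vcons 1 (fun k => k + 3)) =
        vcons y (vcons x v) := by
      intro q x y
      funext k; rcases k with _ | _ | k <;> rfl
    simp only [e, h S hS, vcons_zero, vcons_succ]
    constructor
    · intro H
      obtain ⟨q, hq⟩ := hcoll n (by omega) Q hQ S hS v (v j) H
      refine ⟨q, ?_⟩
      rintro ⟨x, hx, hall⟩
      obtain ⟨y, hy, hn⟩ := hq x hx
      exact hn (hall y hy)
    · rintro ⟨q, hq⟩ x hx
      by_contra hne
      push Not at hne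
      exact hq ⟨x, hx, fun y _ => hne y⟩

lemma CollScheme.collRel_not_of_lt (hC : ∀ S, C S → SatDB0 S.2) {m k : ℕ} {S : Str} (hS : C S)
    (h : CollScheme S.2 (IsSigma m)) (hk : k < m) {Q : Rel} (hQ : DefS C k Q) :
    CollRel S (fun S v => ¬ Q S v) := by
  refine h.collRel hC hS ?_
  obtain ⟨d, rfl⟩ := Nat.exists_eq_add_of_lt hk
  clear hk h
  induction d with
  | zero => exact hQ.not_succ hC
  | succ d ih => exact ih.succ hC

end Definability

lemma CollScheme.collSScheme {K : Type} {E : K → K → Prop} (hE : SatDB0 E) {n : ℕ}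
    (h : CollScheme E (IsSigma (n + 2))) : CollSScheme E (IsSigma (n + 1)) := by
  let C : Str → Prop := fun S => SatDB0 S.2
  have hC : ∀ S, C S → SatDB0 S.2 := fun _ h => h
  intro φ hφ hfv v p
  have hR := ((defS_of_level (C := C) (n + 1) φ).1 hφ).subst (vcons 1 (vcons 0 (fun _ => 2)))
  have hP := ((hR.succ hC).and_or hC (((hR.ex_succ hC).subst Nat.succ).not_succ hC)).2
  obtain ⟨e, -⟩ := hE.2.1
  have key := CollScheme.collRel (S := ⟨K, E⟩) hC hE h hP (fun _ => v) p
  have e1 : ∀ x y : K, vcons y (vcons x fun _ => v) ∘ vcons 1 (vcons 0 (fun _ => 2)) =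
      val3 x y v := by
    intro x y
    funext k; rcases k with _ | _ | k <;> rfl
  have e2 : ∀ x y : K, vcons y (vcons x fun _ => v) ∘ Nat.succ = vcons x fun _ => v :=
    fun x y => rfl
  simp only [e1, e2] at key
  obtain ⟨q, hq⟩ := key fun x _ => by
    by_cases hx : ∃ y, Sat E (val3 x y v) φ
    · exact ⟨hx.choose, .inl hx.choose_spec⟩
    · exact ⟨e, .inr hx⟩
  refine ⟨q, fun x hx => ⟨fun hy => ?_, fun ⟨y, _, hy⟩ => ⟨y, hy⟩⟩⟩
  obtain ⟨y, hyq, hy' | hy'⟩ := hq x hx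
  · exact ⟨y, hyq, hy'⟩
  · exact absurd hy hy'

lemma CollSScheme.collScheme {K : Type} {E : K → K → Prop} {n : ℕ}
    (h : CollSScheme E (IsSigma n)) : CollScheme E (IsSigma n) := by
  intro φ hφ hfv v p H
  obtain ⟨q, hq⟩ := h φ hφ hfv v p
  exact ⟨q, fun x hx => (hq x hx).1 (H x hx)⟩

/-! ### Transfer along cofinal extensions -/

section Transfer

variable {C : Str → Prop} {M N : Type} {EM : M → M → Prop} {EN : N → N → Prop} {f : M → N}

/-- `f` preserves and reflects all relations that are Σ_n-definable over `C`. -/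
def ElemDefS (C : Str → Prop) (n : ℕ) (EM : M → M → Prop) (EN : N → N → Prop) (f : M → N) :
    Prop :=
  ∀ R : Rel, DefS C n R → ∀ v : ℕ → M, R ⟨M, EM⟩ v ↔ R ⟨N, EN⟩ (f ∘ v)

lemma ElemDefS.sigmaElemEmb {n : ℕ} (h : ElemDefS C n EM EN f) : SigmaElemEmb n EM EN f :=
  fun φ hφ => h _ ((defS_of_level n φ).1 hφ)

lemma Delta0ElemEmb.elemDefS_zero (hM : C ⟨M, EM⟩) (hN : C ⟨N, EN⟩)
    (h : Delta0ElemEmb EM EN f) : ElemDefS C 0 EM EN f := by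
  rintro R ⟨φ, hφ, e⟩ v
  rw [e _ hM, e _ hN]
  exact h φ hφ v

lemma ElemDefS.up {n : ℕ} (hM : C ⟨M, EM⟩) (hN : C ⟨N, EN⟩) (h : ElemDefS C n EM EN f)
    {R : Rel} (hR : DefS C (n + 1) R) {v : ℕ → M} (hv : R ⟨M, EM⟩ v) :
    R ⟨N, EN⟩ (f ∘ v) := by
  obtain ⟨Q, hQ, e⟩ := hR
  obtain ⟨a, ha⟩ := (e _ hM v).1 hv
  refine (e _ hN _).2 ⟨f a, ?_⟩
  rw [← comp_vcons]
  exact fun h' => ha ((h Q hQ _).2 h')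

lemma ElemDefS.one (hM : C ⟨M, EM⟩) (hN : C ⟨N, EN⟩) (h : ElemDefS C 0 EM EN f)
    (hcf : Cofinal EN f) : ElemDefS C 1 EM EN f := by
  refine fun R hR v => ⟨h.up hM hN hR, fun hv => ?_⟩
  obtain ⟨Q, hQ, e⟩ := hR
  obtain ⟨a, ha⟩ := (e _ hN _).1 hv
  obtain ⟨m, hm⟩ := hcf a
  have hT := (hQ.not_zero.subst (vcons 0 (fun k => k + 2))).bex_zero 0
  have e' : ∀ {K : Type} (a b : K) (v : ℕ → K),
      vcons a (vcons b v) ∘ vcons 0 (fun k => k + 2) = vcons a v := by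
    intro K a b v
    funext k; cases k <;> rfl
  have key := h _ hT (vcons m v)
  simp only [comp_vcons, e', vcons_zero] at key
  obtain ⟨b, -, hb⟩ := key.2 ⟨a, hm, ha⟩
  exact (e _ hM _).2 ⟨b, hb⟩

lemma ElemDefS.add_two (hC : ∀ S, C S → SatDB0 S.2) {n : ℕ} (hM : C ⟨M, EM⟩)
    (hN : C ⟨N, EN⟩) (h : ElemDefS C (n + 1) EM EN f) (hcf : Cofinal EN f)
    (hcoll : ∀ k < n, ∀ Q, DefS C k Q → ∀ S, C S → CollRel S (fun S v => ¬ Q S v))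
    (hcollM : ∀ Q, DefS C n Q → CollRel ⟨M, EM⟩ (fun S v => ¬ Q S v)) :
    ElemDefS C (n + 2) EM EN f := by
  refine fun R hR v => ⟨h.up hM hN hR, fun hv => ?_⟩
  obtain ⟨Q, ⟨P, hP, e'⟩, e⟩ := hR
  obtain ⟨a, ha⟩ := (e _ hN _).1 hv
  obtain ⟨m, hm⟩ := hcf a
  rw [e _ hM]
  by_contra hne
  push Not at hne
  simp only [e' _ hM] at hne
  obtain ⟨q, hq⟩ := hcollM P hP v m fun x _ => hne x
  have hU := ((hP.subst (vcons 0 (vcons 1 (fun k => k + 4)))).ball hC hcoll 2).bex hC 0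
  have e1 : ∀ {K : Type} (y x b c : K) (v : ℕ → K),
      vcons y (vcons x (vcons b (vcons c v))) ∘ vcons 0 (vcons 1 (fun k => k + 4)) =
        vcons y (vcons x v) := by
    intro K y x b c v
    funext k; rcases k with _ | _ | k <;> rfl
  have key := h _ (hU.succ hC) (vcons m (vcons q v))
  simp only [comp_vcons, e1, vcons_zero, vcons_two, vcons_one] at key
  rw [e' _ hN] at ha
  push Not at ha
  obtain ⟨x, hx, hx'⟩ := key.2 ⟨a, hm, fun y _ => ha y⟩
  obtain ⟨y, hy, hy'⟩ := hq x hx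
  exact hy' (hx' y hy)

lemma CollSScheme.transfer (hC : ∀ S, C S → SatDB0 S.2) {n : ℕ} (hM : C ⟨M, EM⟩)
    (h0 : ElemDefS C 0 EM EN f) (h : ElemDefS C (n + 2) EM EN f)
    (hcf : Cofinal EN f) (hcoll : CollSScheme EM (IsSigma (n + 1))) :
    CollSScheme EN (IsSigma (n + 1)) := by
  intro φ hφ hfv v p
  obtain ⟨m, hm⟩ := hcf v
  obtain ⟨m', hm'⟩ := hcf p
  obtain ⟨s, hs⟩ := (hC _ hM).2.2.2.1 m'
  obtain ⟨c, hc⟩ := (hC _ hM).2.2.2.2.1 s m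
  have hR := (defS_of_level (C := C) (n + 1) φ).1 hφ
  obtain ⟨q, hq⟩ : ∃ q, ∀ x a, EM x s → EM a m → (∃ y, Sat EM (val3 x y a) φ) →
      ∃ y, EM y q ∧ Sat EM (val3 x y a) φ := by
    obtain ⟨R', hR', e⟩ := (hR.subst (vcons 0 (vcons 2 (fun _ => 1)))).merge hC True
    obtain ⟨⟨ψ, hψ, e'⟩, -⟩ := (hR'.subst (vcons 0 (fun _ => 1))).exists_level
    obtain ⟨q, hq⟩ := hcoll _ ((levels_subst (n + 1) ψ _).1 hψ) ψ.fv_subst_min m c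
    refine ⟨q, fun x a hx ha hy => ?_⟩
    obtain ⟨w, hw⟩ := (hC _ hM).exists_opair x a
    have key : ∀ y, Sat EM (val3 w y m) (ψ.subst (fun k => min k 2)) ↔
        Sat EM (val3 x y a) φ := by
      intro y
      rw [sat_subst, val3_comp_min, ← e' ⟨M, EM⟩ hM]
      have e1 : val3 w y m ∘ vcons 0 (fun _ => 1) = vcons w (fun _ => y) := by
        funext k; cases k <;> rfl
      have e2 : vcons x (vcons a (fun _ => y)) ∘ vcons 0 (vcons 2 (fun _ => 1)) =
          val3 x y a := by
        funext k; rcases k with _ | _ | k <;> rfl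
      rw [e1, (e _ hM w _).1 x a hw, e2]
    have hwc := hq w ((hc w).2 ⟨x, a, hx, ha, hw⟩)
    simp only [key] at hwc
    exact hwc.1 hy
  have hR1 := hR.subst (vcons 2 (vcons 0 (fun _ => 1)))
  have hT := ((((hR1.ex_succ hC).succ hC).and_or hC
    ((hR1.bex hC 4).not_succ hC)).1.bex hC 2).bex hC 0
  have e1 : ∀ {K : Type} (y a x : K) (v : ℕ → K),
      vcons y (vcons a (vcons x v)) ∘ vcons 2 (vcons 0 (fun _ => 1)) = val3 x y a := by
    intro K y a x v
    funext k; rcases k with _ | _ | k <;> rfl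
  have key := h _ hT (vcons s (vcons m (fun _ => q)))
  simp only [comp_vcons, e1, vcons_zero, vcons_one, vcons_two, vcons_three, vcons_four] at key
  have hsub := h0 _ (((defS_mem 0 3).ball_zero 0).ball_zero 0) (vcons m' (fun _ => s))
  simp only [comp_vcons, vcons_zero, vcons_one, vcons_two, vcons_three] at hsub
  have hsub' := hsub.1 fun y hy x hx => (hs x).2 ⟨y, hy, hx⟩
  refine ⟨f q, fun x hx => ⟨fun hy => ?_, fun ⟨y, _, hy⟩ => ⟨y, hy⟩⟩⟩
  by_contra hne
  obtain ⟨x', hx', a, ha, hy', hn⟩ := key.2 ⟨x, hsub' p hm' x hx, v, hm, hy, hne⟩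
  exact hn (hq x' a hx' ha hy')

end Transfer

/-- For models M, N of DB₀ with N a Δ₀-elementary cofinal
extension of M and n ≥ 0:
(1) if M ⊨ Coll(Σ_{n+1}) then M ≺_{Σ_{n+2}} N;
(2) if M ⊨ Coll_s(Σ_{n+1}) then N ⊨ Coll_s(Σ_{n+1}). -/
theorem cofinal_transfer (n : ℕ) (M N : Type) (EM : M → M → Prop)
    (EN : N → N → Prop) (f : M → N) (hM : SatDB0 EM) (hN : SatDB0 EN)
    (hΔ : Delta0ElemEmb EM EN f) (hcf : Cofinal EN f) :
    (CollScheme EM (IsSigma (n + 1)) → SigmaElemEmb (n + 2) EM EN f) ∧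
    (CollSScheme EM (IsSigma (n + 1)) → CollSScheme EN (IsSigma (n + 1))) := by
  let C : Str → Prop := fun S => S = ⟨M, EM⟩ ∨ S = ⟨N, EN⟩
  have hC : ∀ S, C S → SatDB0 S.2 := by rintro S (rfl | rfl) <;> assumption
  have hCM : C ⟨M, EM⟩ := .inl rfl
  have hCN : C ⟨N, EN⟩ := .inr rfl
  have h0 : ElemDefS C 0 EM EN f := hΔ.elemDefS_zero hCM hCN
  have main : ∀ n, CollScheme EM (IsSigma (n + 1)) → ElemDefS C (n + 2) EM EN f := by
    intro n
    induction n with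
    | zero =>
      exact fun h => (h0.one hCM hCN hcf).add_two hC hCM hCN hcf (fun k hk => by omega)
        fun Q hQ => h.collRel_not_of_lt hC hCM Nat.one_pos hQ
    | succ n ih =>
      intro h
      have hs := h.collSScheme hM
      have hel := ih hs.collScheme
      have hN' := (hs.transfer hC hCM h0 hel hcf).collScheme
      refine hel.add_two hC hCM hCN hcf (fun k hk Q hQ S hS => ?_)
        fun Q hQ => h.collRel_not_of_lt hC hCM (Nat.lt_succ_self _) hQ
      rcases hS with rfl | rfl
      · exact hs.collScheme.collRel_not_of_lt hC hCM hk hQ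
      · exact hN'.collRel_not_of_lt hC hCN hk hQ
  exact ⟨fun h => (main n h).sigmaElemEmb,
    fun h => h.transfer hC hCM h0 (main n h.collScheme) hcf⟩

end FOSet
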